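/- Let n and D be positive integers. There exists a code C ⊆ S_n with |C| ≤ (n!/B_C(D))·(1 + ln B_C(D)) such that every permutation π ∈ S_n satisfies d_C(π,C) ≤ D. -/

import Mathlib

/-- Chebyshev distance between two permutations: the maximum of `|π i - σ i|`. -/
def chebDist {n : ℕ} (π σ : Equiv.Perm (Fin n)) : ℕ :=
  Finset.univ.sup fun i => Nat.dist (π i : ℕ) (σ i : ℕ)

/-- `chebBall n r` is the number of permutations in `S_n` at Chebyshev
distance at most `r` from the identity. -/
def chebBall (n r : ℕ) : ℕ :=
  (Finset.univ.filter (fun σ : Equiv.Perm (Fin n) => chebDist σ 1 ≤ r)).card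

/-- The minimal Chebyshev distance from `π` to a codeword of `C`. -/
noncomputable def chebDistToCode {n : ℕ} (π : Equiv.Perm (Fin n))
    (C : Finset (Equiv.Perm (Fin n))) : ℕ :=
  sInf (chebDist π '' ↑C)

open Finset

/-- A bound for the number of steps of the greedy covering algorithm when `u` points remain to be
covered and each step covers at least the fraction `1 / t` of them, and at least one of them. -/
noncomputable def greedyBound (t u : ℝ) : ℝ :=
  if u ≤ t then u else t * (1 + Real.log (u / t))

lemma greedyBound_step {t u v : ℝ} (ht : 0 < t) (h1 : v ≤ u - 1) (h2 : u ≤ t * (u - v)) :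
    1 + greedyBound t v ≤ greedyBound t u := by
  unfold greedyBound
  rcases le_or_gt u t with hu | hu
  · rw [if_pos hu, if_pos (by linarith)]
    linarith
  have hu0 : 0 < u := ht.trans hu
  have key : 1 ≤ t * (1 - v / u) := by
    rw [one_sub_div hu0.ne', ← mul_div_assoc, le_div_iff₀ hu0]
    linarith
  rw [if_neg hu.not_ge]
  split_ifs with hv
  · have hlog : 1 - t / u ≤ Real.log (u / t) := by
      simpa using Real.one_sub_inv_le_log_of_pos (div_pos hu0 ht)
    have hprod : 0 ≤ (t - v) * (1 - t / u) :=
      mul_nonneg (by linarith) (by rw [sub_nonneg, div_le_one hu0]; exact hu.le)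
    have hmul := mul_le_mul_of_nonneg_left hlog ht.le
    have hswap : v * (t / u) = t * (v / u) := by ring
    linarith
  · have hv0 : 0 < v := ht.trans (not_le.mp hv)
    have hlog : 1 - v / u ≤ Real.log (u / v) := by
      simpa using Real.one_sub_inv_le_log_of_pos (div_pos hu0 hv0)
    have hmul := mul_le_mul_of_nonneg_left hlog ht.le
    rw [Real.log_div hu0.ne' hv0.ne'] at hmul
    rw [Real.log_div hu0.ne' ht.ne', Real.log_div hv0.ne' ht.ne']
    linarith

/-- If every point is related to exactly `b` points, then some point is related to at least the
average number of points of `U`. -/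
lemma exists_mul_card_le_card_mul_filter {α : Type*} [Fintype α] [Nonempty α] (R : α → α → Prop)
    [DecidableRel R] {b : ℕ} (hR : ∀ x, #{y | R x y} = b) (U : Finset α) :
    ∃ y, #U * b ≤ Fintype.card α * #{x ∈ U | R x y} := by
  by_contra! h
  have hcount : ∑ y, #{x ∈ U | R x y} = #U * b := by
    have := sum_card_bipartiteAbove_eq_sum_card_bipartiteBelow (s := U) (t := univ) R
    simp only [bipartiteAbove, bipartiteBelow, hR, sum_const, smul_eq_mul] at this
    exact this.symm
  have hlt := sum_lt_sum_of_nonempty (univ_nonempty (α := α)) fun y _ => h y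
  rw [← mul_sum, hcount, sum_const, card_univ, smul_eq_mul] at hlt
  exact lt_irrefl _ hlt

lemma exists_greedy_cover {α : Type*} [Fintype α] (R : α → α → Prop)
    [DecidableRel R] {b : ℕ} (hb : 0 < b) (hR : ∀ x, #{y | R x y} = b) (U : Finset α) :
    ∃ C : Finset α, (#C : ℝ) ≤ greedyBound (Fintype.card α / b) #U ∧
      ∀ x ∈ U, ∃ y ∈ C, R x y := by
  classical
  induction U using Finset.strongInduction with
  | H U ih =>
    rcases U.eq_empty_or_nonempty with rfl | hU
    · exact ⟨∅, by simp [greedyBound, show (0 : ℝ) ≤ Fintype.card α / b by positivity]⟩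
    obtain ⟨x₀, hx₀⟩ := hU
    have : Nonempty α := ⟨x₀⟩
    obtain ⟨y, hy⟩ := exists_mul_card_le_card_mul_filter R hR U
    have hpos : 0 < #{x ∈ U | R x y} := by
      have hlhs : 0 < #U * b := Nat.mul_pos (card_pos.mpr ⟨x₀, hx₀⟩) hb
      exact Nat.pos_of_mul_pos_left (hlhs.trans_le hy)
    have hsplit := card_filter_add_card_filter_not (s := U) (fun x => R x y)
    obtain ⟨z, hz⟩ := card_pos.mp hpos
    rw [mem_filter] at hz
    obtain ⟨C, hC, hcov⟩ := ih {x ∈ U | ¬ R x y}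
      (filter_ssubset.mpr ⟨z, hz.1, not_not.mpr hz.2⟩)
    refine ⟨insert y C, ?_, fun x hx => ?_⟩
    · have hins : (#(insert y C) : ℝ) ≤ #C + 1 := by exact_mod_cast card_insert_le y C
      have hsplit' : (#{x ∈ U | R x y} : ℝ) + #{x ∈ U | ¬ R x y} = #U := by exact_mod_cast hsplit
      have hpos' : (1 : ℝ) ≤ #{x ∈ U | R x y} := by exact_mod_cast hpos
      have hy' : (#U : ℝ) * b ≤ Fintype.card α * #{x ∈ U | R x y} := by exact_mod_cast hy
      have hb' : (0 : ℝ) < b := by exact_mod_cast hb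
      have hstep := greedyBound_step (t := Fintype.card α / b) (u := #U)
        (v := #{x ∈ U | ¬ R x y}) (by positivity) (by linarith) (by
          rw [← hsplit', add_sub_cancel_right, hsplit', div_mul_eq_mul_div, le_div_iff₀ hb']
          exact hy')
      linarith
    · by_cases hxy : R x y
      · exact ⟨y, mem_insert_self y C, hxy⟩
      · obtain ⟨w, hw, hxw⟩ := hcov x (mem_filter.mpr ⟨hx, hxy⟩)
        exact ⟨w, mem_insert_of_mem hw, hxw⟩

/-- A relation in which every point has exactly `b > 0` related points admits a covering code of
size at most `(N / b) * (1 + log b)`, where `N` is the number of points. -/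
lemma exists_cover_card_le {α : Type*} [Fintype α] (R : α → α → Prop)
    [DecidableRel R] {b : ℕ} (hb : 0 < b) (hR : ∀ x, #{y | R x y} = b) :
    ∃ C : Finset α, (#C : ℝ) ≤ Fintype.card α / b * (1 + Real.log b) ∧
      ∀ x, ∃ y ∈ C, R x y := by
  obtain ⟨C, hC, hcov⟩ := exists_greedy_cover R hb hR univ
  refine ⟨C, hC.trans ?_, fun x => hcov x (mem_univ x)⟩
  have hb' : (1 : ℝ) ≤ b := by exact_mod_cast hb
  rw [card_univ, greedyBound]
  split_ifs with h
  · exact h.trans (le_mul_of_one_le_right (by positivity)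
      (le_add_of_nonneg_right (Real.log_nonneg hb')))
  · have hN : (Fintype.card α : ℝ) ≠ 0 := fun h0 => h (by simp [h0])
    rw [div_div_cancel₀ hN]

lemma chebDist_mul_inv_one {n : ℕ} (π σ : Equiv.Perm (Fin n)) :
    chebDist (π * σ⁻¹) 1 = chebDist π σ := by
  refine le_antisymm (Finset.sup_le fun i _ => ?_) (Finset.sup_le fun i _ => ?_)
  · simpa [chebDist] using le_sup (f := fun i => Nat.dist (π i : ℕ) (σ i : ℕ)) (mem_univ (σ⁻¹ i))
  · simpa [chebDist] using
      le_sup (f := fun i => Nat.dist ((π * σ⁻¹) i : ℕ) ((1 : Equiv.Perm (Fin n)) i : ℕ))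
        (mem_univ (σ i))

lemma card_chebDist_le {n : ℕ} (r : ℕ) (π : Equiv.Perm (Fin n)) :
    #{σ | chebDist π σ ≤ r} = chebBall n r := by
  refine card_equiv ((Equiv.inv _).trans (Equiv.mulLeft π)) fun σ => ?_
  simp [chebDist_mul_inv_one]

lemma chebBall_pos (n r : ℕ) : 0 < chebBall n r :=
  card_pos.mpr ⟨1, by simp [chebDist, Nat.dist_self]⟩

/-- There is a covering code for worst-case Chebyshev distortion `D` of size at most
`(n!/B_C(D))·(1 + ln B_C(D))`. -/
theorem stmt_5 (n D : ℕ) (hn : 0 < n) (hD : 0 < D) :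
    ∃ C : Finset (Equiv.Perm (Fin n)),
      (C.card : ℝ) ≤ ((n.factorial : ℝ) / (chebBall n D : ℝ)) *
        (1 + Real.log (chebBall n D : ℝ)) ∧
      ∀ π : Equiv.Perm (Fin n), ∃ σ ∈ C, chebDist π σ ≤ D := by
  simpa [Fintype.card_perm] using
    exists_cover_card_le (fun π σ : Equiv.Perm (Fin n) => chebDist π σ ≤ D)
      (chebBall_pos n D) (card_chebDist_le D)
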